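/- For every real ε > 0 there exists an integer N such that every connected cubic (3-regular) graph G of order at least N satisfies FTD(G) ≥ 2 − ε. (That is, connected cubic graphs have fractional total domatic number at least 2 − o(1).) -/

import Mathlib

/-- The number of members of the family `F` (counted with multiplicity) containing `v`. -/
def appearCount {V : Type*} [DecidableEq V] (F : Multiset (Finset V)) (v : V) : ℕ :=
  Multiset.countP (fun S => v ∈ S) F

/-- `r_F`: the maximum, over all vertices `v`, of the number of members of `F` containing `v`. -/
def maxAppear {V : Type*} [Fintype V] [DecidableEq V] (F : Multiset (Finset V)) : ℕ :=
  Finset.univ.sup fun v : V => appearCount F v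

/-- `S` is a total dominating set of `G`: every vertex of `G` has a neighbor in `S`. -/
def IsTotalDomSet {V : Type*} (G : SimpleGraph V) (S : Finset V) : Prop :=
  ∀ v : V, ∃ u ∈ S, G.Adj v u

/-- The fractional total domatic number `FTD(G)`: the supremum of the effective ratio
`|F| / r_F` over all nonempty thoroughly distributed families `F` of `G`, i.e. finite
families (with repetition allowed) of total dominating sets of `G`. -/
noncomputable def FTD {V : Type*} [Fintype V] [DecidableEq V] (G : SimpleGraph V) : ℝ :=
  sSup { r : ℝ | ∃ F : Multiset (Finset V), F ≠ 0 ∧ (∀ S ∈ F, IsTotalDomSet G S) ∧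
      r = (Multiset.card F : ℝ) / (maxAppear F : ℝ) }


/-- Seymour-type lemma: if every nonempty subfamily `T'` of the hyperedges `e t`, `t ∈ T`,
covers more than `|T'|` vertices, then there is a 2-colouring with every edge bichromatic. -/
lemma exists_two_coloring {V : Type*} [Fintype V] [DecidableEq V] (e : V → Finset V) :
    ∀ (n : ℕ) (T : Finset V), T.card = n →
      (∀ T' ⊆ T, T'.Nonempty → T'.card < (T'.biUnion e).card) →
      ∃ c : V → Prop, ∀ t ∈ T, (∃ u ∈ e t, c u) ∧ (∃ u ∈ e t, ¬ c u) := by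
  intro n
  induction n using Nat.strong_induction_on with
  | _ n ih =>
  intro T hT hH
  rcases T.eq_empty_or_nonempty with rfl | hne
  · exact ⟨fun _ => True, by simp⟩
  have hlt := hH T subset_rfl hne
  set W := T.biUnion e with hW
  -- a nontrivial kernel vector
  let L : (W → ℝ) →ₗ[ℝ] (T → ℝ) :=
    { toFun := fun x t => ∑ w : W, if (w : V) ∈ e t then x w else 0
      map_add' := by
        intro x y; ext t
        simp only [Pi.add_apply, ← Finset.sum_add_distrib]
        refine Finset.sum_congr rfl fun w _ => ?_
        split_ifs <;> simp
      map_smul' := by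
        intro r x; ext t
        simp [Finset.mul_sum] }
  have hker : LinearMap.ker L ≠ ⊥ := by
    apply LinearMap.ker_ne_bot_of_finrank_lt
    simpa using hlt
  obtain ⟨x, hx, hx0⟩ := (Submodule.ne_bot_iff _).1 hker
  obtain ⟨w0, hw0⟩ := Function.ne_iff.1 hx0
  let y : V → ℝ := fun v => if h : v ∈ W then x ⟨v, h⟩ else 0
  have hy0 : y w0 ≠ 0 := by simpa [y] using hw0
  have hysum : ∀ t ∈ T, ∑ v ∈ e t, y v = 0 := by
    intro t ht
    have h1 : L x ⟨t, ht⟩ = 0 := by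
      rw [LinearMap.mem_ker.1 hx]; rfl
    have h2 : L x ⟨t, ht⟩ = ∑ w : W, if (w : V) ∈ e t then y w else 0 := by
      change (∑ w : W, if (w : V) ∈ e t then x w else 0) = _
      refine Finset.sum_congr rfl fun w _ => ?_
      simp [y]
    rw [h2, Finset.sum_coe_sort W (fun w => if w ∈ e t then y w else 0),
      ← Finset.sum_filter] at h1
    rw [← h1]
    refine Finset.sum_congr ?_ fun _ _ => rfl
    ext v
    simp only [Finset.mem_filter, hW, Finset.mem_biUnion]
    exact ⟨fun h => ⟨⟨t, ht, h⟩, h⟩, fun h => h.2⟩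
  let T' := T.filter fun t => ∀ v ∈ e t, y v = 0
  have hT'T : T' ⊆ T := Finset.filter_subset _ _
  have hT'lt : T'.card < n := by
    rw [← hT]
    apply Finset.card_lt_card
    refine Finset.filter_ssubset.2 ?_
    obtain ⟨t, ht, htw⟩ := Finset.mem_biUnion.1 w0.2
    exact ⟨t, ht, fun h => hy0 (h _ htw)⟩
  obtain ⟨c, hc⟩ := ih _ hT'lt T' rfl fun T'' h => hH T'' (h.trans hT'T)
  refine ⟨fun v => 0 < y v ∨ (y v = 0 ∧ c v), fun t ht => ?_⟩
  by_cases hz : ∀ v ∈ e t, y v = 0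
  · obtain ⟨⟨u, hu, hcu⟩, ⟨u', hu', hcu'⟩⟩ := hc t (Finset.mem_filter.2 ⟨ht, hz⟩)
    refine ⟨⟨u, hu, Or.inr ⟨hz u hu, hcu⟩⟩, ⟨u', hu', ?_⟩⟩
    simp [hz u' hu', hcu']
  · push Not at hz
    obtain ⟨v, hv, hyv⟩ := hz
    have hs := hysum t ht
    obtain ⟨u, hu, hu0⟩ := Finset.exists_pos_of_sum_zero_of_exists_nonzero y hs ⟨v, hv, hyv⟩
    obtain ⟨u', hu', hu'0⟩ := Finset.exists_pos_of_sum_zero_of_exists_nonzero (fun v => - y v)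
      (by simpa using hs) ⟨v, hv, by simpa using hyv⟩
    refine ⟨⟨u, hu, Or.inl hu0⟩, ⟨u', hu', ?_⟩⟩
    have : y u' < 0 := by simpa using hu'0
    rintro (h | h)
    · linarith
    · linarith [h.1]

/-- Expansion of neighbourhoods of sets missing two adjacent vertices. -/
lemma card_lt_card_biUnion {V : Type*} [Fintype V] [DecidableEq V] (G : SimpleGraph V)
    [DecidableRel G.Adj] (hc : G.Connected) (hr : G.IsRegularOfDegree 3) {v w : V}
    (hvw : G.Adj v w) (T : Finset V) (hv : v ∉ T) (hw : w ∉ T) (hne : T.Nonempty) :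
    T.card < (T.biUnion fun t => G.neighborFinset t).card := by
  by_contra hle
  push Not at hle
  set S := T.biUnion fun t => G.neighborFinset t with hS
  have hcount := Finset.sum_card_bipartiteAbove_eq_sum_card_bipartiteBelow
    (s := T) (t := S) (fun a b => G.Adj a b)
  have habove : ∀ a ∈ T, (S.bipartiteAbove (fun a b => G.Adj a b) a).card = 3 := by
    intro a ha
    rw [← hr a, ← G.card_neighborFinset_eq_degree]
    congr 1
    ext b
    simp only [Finset.mem_bipartiteAbove, SimpleGraph.mem_neighborFinset, hS,
      Finset.mem_biUnion]
    exact ⟨fun h => h.2, fun h => ⟨⟨a, ha, h⟩, h⟩⟩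
  rw [Finset.sum_congr rfl habove] at hcount
  have hsub : ∀ b, T.bipartiteBelow (fun a b => G.Adj a b) b ⊆ G.neighborFinset b := by
    intro b a ha
    rw [Finset.mem_bipartiteBelow] at ha
    simpa using ha.2.symm
  have hbelow : ∀ b ∈ S, (T.bipartiteBelow (fun a b => G.Adj a b) b).card ≤ 3 := by
    intro b _
    have := Finset.card_le_card (hsub b)
    rwa [G.card_neighborFinset_eq_degree, hr b] at this
  have hclosed : ∀ b ∈ S, ∀ a, G.Adj b a → a ∈ T := by
    intro b hb a hba
    have heq : (T.bipartiteBelow (fun a b => G.Adj a b) b).card = 3 := by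
      by_contra hne3
      have := Finset.sum_lt_sum hbelow ⟨b, hb, lt_of_le_of_ne (hbelow b hb) hne3⟩
      simp only [Finset.sum_const, smul_eq_mul] at this hcount
      omega
    have h2 := Finset.eq_of_subset_of_card_le (hsub b)
      (by rw [heq, G.card_neighborFinset_eq_degree, hr b])
    have : a ∈ T.bipartiteBelow (fun a b => G.Adj a b) b := by rw [h2]; simpa using hba
    exact (Finset.mem_bipartiteBelow _ |>.1 this).1
  obtain ⟨t, ht⟩ := hne
  have hall : ∀ u, u ∈ T ∨ u ∈ S := by
    intro u
    obtain ⟨p⟩ := hc.preconnected u t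
    induction p with
    | nil => exact Or.inl ht
    | cons h p ih =>
      rcases ih ht with h1 | h1
      · exact Or.inr (Finset.mem_biUnion.2 ⟨_, h1, by simpa using h.symm⟩)
      · exact Or.inl (hclosed _ h1 _ h.symm)
  rcases hall v with h | h
  · exact hv h
  · exact hw (hclosed v h w hvw)

lemma card_le_sum_appearCount {V : Type*} [Fintype V] [DecidableEq V]
    (F : Multiset (Finset V)) (hF : ∀ S ∈ F, S.Nonempty) :
    Multiset.card F ≤ ∑ v, appearCount F v := by
  induction F using Multiset.induction_on with
  | empty => simp
  | cons S F ih =>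
    have h1 := ih fun S' h => hF S' (Multiset.mem_cons_of_mem h)
    have h2 : 1 ≤ S.card := (hF S (Multiset.mem_cons_self _ _)).card_pos
    simp only [appearCount, Multiset.countP_cons, Finset.sum_add_distrib, Multiset.card_cons]
      at h1 ⊢
    have h3 : (∑ x : V, if x ∈ S then 1 else 0) = S.card := by simp
    omega

lemma card_le_mul_maxAppear {V : Type*} [Fintype V] [DecidableEq V] [Nonempty V]
    (G : SimpleGraph V)
    (F : Multiset (Finset V)) (hF : ∀ S ∈ F, IsTotalDomSet G S) :
    Multiset.card F ≤ Fintype.card V * maxAppear F := by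
  refine (card_le_sum_appearCount F fun S hS => ?_).trans ?_
  · obtain ⟨u, hu, _⟩ := hF S hS (Classical.arbitrary V)
    exact ⟨u, hu⟩
  · refine (Finset.sum_le_card_nsmul _ _ (maxAppear F) fun v hv => ?_).trans (by simp)
    exact Finset.le_sup (f := fun v : V => appearCount F v) hv

lemma exists_family {V : Type*} [Fintype V] [DecidableEq V] (G : SimpleGraph V)
    [DecidableRel G.Adj] (hc : G.Connected) (hr : G.IsRegularOfDegree 3) :
    ∃ F : Multiset (Finset V), (∀ S ∈ F, IsTotalDomSet G S) ∧
      Multiset.card F = 2 * Fintype.card V ∧ maxAppear F ≤ Fintype.card V + 4 := by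
  classical
  have hf : ∀ v, ∃ w, G.Adj v w := by
    intro v
    have h : 0 < G.degree v := by rw [hr v]; norm_num
    exact (G.degree_pos_iff_exists_adj v).1 h
  choose f hf using hf
  have hcol : ∀ v, ∃ c : V → Prop, ∀ t, t ≠ v → t ≠ f v →
      (∃ u, G.Adj t u ∧ c u) ∧ (∃ u, G.Adj t u ∧ ¬ c u) := by
    intro v
    obtain ⟨c, hcc⟩ := exists_two_coloring (fun t => G.neighborFinset t) _
      (Finset.univ \ {v, f v}) rfl (fun T' hT' hne => by
        refine card_lt_card_biUnion G hc hr (hf v) T' (fun h => ?_) (fun h => ?_) hne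
        · simpa using hT' h
        · simpa using hT' h)
    refine ⟨c, fun t h1 h2 => ?_⟩
    simpa using hcc t (by simp [h1, h2])
  choose c hcol using hcol
  let A : V → Finset V := fun v => Finset.univ.filter fun u => u = v ∨ u = f v ∨ c v u
  let B : V → Finset V := fun v => Finset.univ.filter fun u => u = v ∨ u = f v ∨ ¬ c v u
  refine ⟨Finset.univ.val.map A + Finset.univ.val.map B, ?_, ?_, ?_⟩
  · intro S hS t
    rw [Multiset.mem_add, Multiset.mem_map, Multiset.mem_map] at hS
    rcases hS with ⟨v, _, rfl⟩ | ⟨v, _, rfl⟩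
    all_goals
      by_cases h1 : t = v
      · exact ⟨f v, by simp [A, B], h1 ▸ hf t⟩
      by_cases h2 : t = f v
      · exact ⟨v, by simp [A, B], h2 ▸ (hf v).symm⟩
      obtain ⟨⟨u, hu, hcu⟩, ⟨u', hu', hcu'⟩⟩ := hcol v t h1 h2
      first
      | exact ⟨u, by simp [A, hcu], hu⟩
      | exact ⟨u', by simp [B, hcu'], hu'⟩
  · simp [two_mul]
  · refine Finset.sup_le fun u _ => ?_
    have hcnt : appearCount (Finset.univ.val.map A + Finset.univ.val.map B) u =
        (Finset.univ.filter fun v => u ∈ A v).card +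
        (Finset.univ.filter fun v => u ∈ B v).card := by
      simp only [appearCount, Multiset.countP_add, Multiset.countP_map]
      rfl
    rw [hcnt, ← Finset.card_union_add_card_inter]
    refine Nat.add_le_add (Finset.card_le_univ _) ?_
    have hsub : (Finset.univ.filter fun v => u ∈ A v) ∩ (Finset.univ.filter fun v => u ∈ B v) ⊆
        insert u (G.neighborFinset u) := by
      intro v hv
      simp only [Finset.mem_inter, Finset.mem_filter, Finset.mem_univ, true_and, A, B] at hv
      rw [Finset.mem_insert, SimpleGraph.mem_neighborFinset]
      by_cases h1 : u = v
      · exact Or.inl h1.symm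
      by_cases h2 : u = f v
      · exact Or.inr (h2 ▸ (hf v).symm)
      · tauto
    refine (Finset.card_le_card hsub).trans ((Finset.card_insert_le _ _).trans ?_)
    rw [G.card_neighborFinset_eq_degree, hr u]

theorem stmt15 (ε : ℝ) (hε : 0 < ε) :
    ∃ N : ℕ, ∀ (V : Type) [Fintype V] [DecidableEq V] (G : SimpleGraph V)
      [DecidableRel G.Adj], G.Connected → G.IsRegularOfDegree 3 →
      N ≤ Fintype.card V → 2 - ε ≤ FTD G := by
  obtain ⟨N, hN⟩ := exists_nat_ge (8 / ε)
  refine ⟨N, ?_⟩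
  intro V _ _ G _ hc hr hcard
  haveI := hc.nonempty
  obtain ⟨F, hF, hFc, hFm⟩ := exists_family G hc hr
  have hpos : 0 < Fintype.card V := Fintype.card_pos
  have hle := card_le_mul_maxAppear G F hF
  have hmpos : 0 < maxAppear F := by
    rcases Nat.eq_zero_or_pos (maxAppear F) with h | h
    · rw [h] at hle; omega
    · exact h
  have hbdd : BddAbove { r : ℝ | ∃ F : Multiset (Finset V), F ≠ 0 ∧
      (∀ S ∈ F, IsTotalDomSet G S) ∧
      r = (Multiset.card F : ℝ) / (maxAppear F : ℝ) } := by
    refine ⟨Fintype.card V, ?_⟩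
    rintro r ⟨F', _, hF', rfl⟩
    apply div_le_of_le_mul₀ (by positivity) (by positivity)
    exact_mod_cast card_le_mul_maxAppear G F' hF'
  have hmem : (Multiset.card F : ℝ) / (maxAppear F : ℝ) ≤ FTD G := by
    refine le_csSup hbdd ⟨F, ?_, hF, rfl⟩
    rintro rfl
    simp at hFc
  refine le_trans ?_ hmem
  have hm : (0 : ℝ) < maxAppear F := by exact_mod_cast hmpos
  have hm2 : (maxAppear F : ℝ) ≤ Fintype.card V + 4 := by exact_mod_cast hFm
  have hFc' : (Multiset.card F : ℝ) = 2 * Fintype.card V := by exact_mod_cast hFc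
  have hn : (8 : ℝ) / ε ≤ Fintype.card V := hN.trans (by exact_mod_cast hcard)
  rw [div_le_iff₀ hε] at hn
  have hn0 : (0 : ℝ) < Fintype.card V := by exact_mod_cast hpos
  rw [le_div_iff₀ hm, hFc']
  rcases le_total ε 2 with h | h
  · nlinarith
  · nlinarith
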